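/- arXiv:2110.09683 — 6 statements merged into one kernel-verified Lean document; each statement's English description precedes it below -/
import Mathlib

section
/- Let γ⁰,γ¹,γ²,γ³ be Dirac matrices satisfying in addition the hermiticity conditions γ⁰ (γ^μ)† γ⁰ = γ^μ for all μ. Let ψ ∈ ℂ and ψ₀,ψ₁,ψ₂,ψ₃ ∈ ℂ, and set Ψ = ψ I + Σ_μ ψ_μ γ^μ. Then the Riesz tensor T^{μν} := (1/4) tr(Ψ̄ γ^μ Ψ γ^ν) satisfies T^{μν} = (|ψ|² − Σ_{α,β} η^{αβ} ψ*_α ψ_β) η^{μν} + ψ*^μ ψ^ν + ψ^μ ψ*^ν, where ψ^μ := Σ_ν η^{μν} ψ_ν. In particular every component T^{μν} is a real number and T^{μν} = T^{νμ}. -/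
open Matrix
noncomputable section

/-- The Minkowski metric `η = diag(1,-1,-1,-1)` on `ℝ⁴`. -/
def mink (μ ν : Fin 4) : ℝ := if μ = ν then (if μ = 0 then 1 else -1) else 0

theorem mink_comm (μ ν : Fin 4) : mink μ ν = mink ν μ := by
  unfold mink
  split_ifs <;> simp_all

theorem mink_zero_zero : mink 0 0 = 1 := by simp [mink]

section DiracTraces

variable {γ : Fin 4 → Matrix (Fin 4) (Fin 4) ℂ}

theorem dirac_swap
    (hγ : ∀ μ ν, γ μ * γ ν + γ ν * γ μ
      = (2 * (mink μ ν : ℂ)) • (1 : Matrix (Fin 4) (Fin 4) ℂ)) (a b : Fin 4) :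
    γ a * γ b = (2 * (mink a b : ℂ)) • (1 : Matrix (Fin 4) (Fin 4) ℂ) - γ b * γ a :=
  eq_sub_of_add_eq (hγ a b)

theorem dirac_sq
    (hγ : ∀ μ ν, γ μ * γ ν + γ ν * γ μ
      = (2 * (mink μ ν : ℂ)) • (1 : Matrix (Fin 4) (Fin 4) ℂ)) (a : Fin 4) :
    γ a * γ a = (mink a a : ℂ) • (1 : Matrix (Fin 4) (Fin 4) ℂ) := by
  have h := hγ a a
  rw [← two_smul ℂ, mul_smul] at h
  exact smul_right_injective _ (two_ne_zero' ℂ) h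

theorem trace_dirac_mul
    (hγ : ∀ μ ν, γ μ * γ ν + γ ν * γ μ
      = (2 * (mink μ ν : ℂ)) • (1 : Matrix (Fin 4) (Fin 4) ℂ)) (a b : Fin 4) :
    trace (γ a * γ b) = 4 * (mink a b : ℂ) := by
  have h := congrArg trace (hγ a b)
  rw [trace_add, trace_mul_comm (γ b), trace_smul, trace_one] at h
  simp only [Fintype.card_fin, smul_eq_mul, Nat.cast_ofNat] at h
  linear_combination h / 2

theorem trace_dirac_mul_three
    (hγ : ∀ μ ν, γ μ * γ ν + γ ν * γ μ
      = (2 * (mink μ ν : ℂ)) • (1 : Matrix (Fin 4) (Fin 4) ℂ)) (a b c : Fin 4) :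
    trace (γ a * γ b * γ c) = 0 := by
  obtain ⟨d, ha, hb, hc⟩ : ∃ d, d ≠ a ∧ d ≠ b ∧ d ≠ c := by
    revert a b c
    decide
  have anti : ∀ e, d ≠ e → γ d * γ e = -(γ e * γ d) := fun e he => by
    rw [dirac_swap hγ, mink, if_neg he]
    simp
  have move : γ d * (γ a * γ b * γ c) = -(γ a * γ b * γ c * γ d) := by
    calc γ d * (γ a * γ b * γ c) = γ d * γ a * γ b * γ c := by simp only [mul_assoc]
      _ = -(γ a * (γ d * γ b) * γ c) := by rw [anti a ha]; noncomm_ring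
      _ = γ a * γ b * (γ d * γ c) := by rw [anti b hb]; noncomm_ring
      _ = -(γ a * γ b * γ c * γ d) := by rw [anti c hc]; noncomm_ring
  have key : trace (γ a * γ b * γ c * (γ d * γ d)) = -trace (γ a * γ b * γ c * (γ d * γ d)) := by
    conv_lhs => rw [← mul_assoc, trace_mul_comm, ← mul_assoc, move]
    rw [neg_mul, trace_neg, mul_assoc (γ a * γ b * γ c)]
  rw [dirac_sq hγ, mul_smul_comm, mul_one, trace_smul, smul_eq_mul] at key
  have hd : (mink d d : ℂ) ≠ 0 := by
    unfold mink
    split_ifs <;> simp_all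
  exact (mul_eq_zero.mp (self_eq_neg.mp key)).resolve_left hd

theorem trace_dirac_mul_four
    (hγ : ∀ μ ν, γ μ * γ ν + γ ν * γ μ
      = (2 * (mink μ ν : ℂ)) • (1 : Matrix (Fin 4) (Fin 4) ℂ)) (a b c d : Fin 4) :
    trace (γ a * γ b * γ c * γ d) = 4 * ((mink a b : ℂ) * mink c d
      - (mink a c : ℂ) * mink b d + (mink a d : ℂ) * mink b c) := by
  have h : γ a * γ b * γ c * γ d = (2 * (mink a b : ℂ)) • (γ c * γ d)
      - (2 * (mink a c : ℂ)) • (γ b * γ d) + (2 * (mink a d : ℂ)) • (γ b * γ c)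
      - γ b * γ c * γ d * γ a := by
    calc γ a * γ b * γ c * γ d
        = (2 * (mink a b : ℂ)) • (γ c * γ d) - γ b * (γ a * γ c) * γ d := by
          rw [dirac_swap hγ a b]
          simp only [sub_mul, smul_mul_assoc, one_mul, mul_assoc]
      _ = (2 * (mink a b : ℂ)) • (γ c * γ d) - (2 * (mink a c : ℂ)) • (γ b * γ d)
          + γ b * γ c * (γ a * γ d) := by
          rw [dirac_swap hγ a c]
          simp only [sub_mul, mul_sub, smul_mul_assoc, mul_smul_comm, mul_one, mul_assoc]
          abel
      _ = _ := by
          rw [dirac_swap hγ a d]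
          simp only [mul_sub, mul_smul_comm, mul_one, mul_assoc]
          abel
  have ht := congrArg trace h
  rw [trace_sub, trace_mul_comm (γ b * γ c * γ d), trace_add, trace_sub, trace_smul, trace_smul,
    trace_smul, trace_dirac_mul hγ, trace_dirac_mul hγ, trace_dirac_mul hγ,
    ← mul_assoc, ← mul_assoc] at ht
  simp only [smul_eq_mul] at ht
  linear_combination ht / 2

/-- The Dirac adjoint conjugates the coefficients of a combination of `1` and Dirac matrices. -/
theorem dirac_adjoint_eq
    (hγ : ∀ μ ν, γ μ * γ ν + γ ν * γ μ
      = (2 * (mink μ ν : ℂ)) • (1 : Matrix (Fin 4) (Fin 4) ℂ))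
    (hHerm : ∀ μ, γ 0 * (γ μ)ᴴ * γ 0 = γ μ) (s : ℂ) (v : Fin 4 → ℂ) :
    γ 0 * (s • (1 : Matrix (Fin 4) (Fin 4) ℂ) + ∑ μ, v μ • γ μ)ᴴ * γ 0
      = starRingEnd ℂ s • (1 : Matrix (Fin 4) (Fin 4) ℂ) + ∑ μ, starRingEnd ℂ (v μ) • γ μ := by
  simp only [conjTranspose_add, conjTranspose_smul, conjTranspose_one, conjTranspose_sum, mul_add,
    add_mul, Finset.mul_sum, Finset.sum_mul, mul_smul_comm, smul_mul_assoc, mul_one, hHerm,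
    dirac_sq hγ, mink_zero_zero, Complex.ofReal_one, one_smul, starRingEnd_apply]

theorem trace_dirac_sandwich
    (hγ : ∀ μ ν, γ μ * γ ν + γ ν * γ μ
      = (2 * (mink μ ν : ℂ)) • (1 : Matrix (Fin 4) (Fin 4) ℂ))
    (s t : ℂ) (v w : Fin 4 → ℂ) (μ ν : Fin 4) :
    trace ((s • (1 : Matrix (Fin 4) (Fin 4) ℂ) + ∑ α, v α • γ α) * γ μ
        * (t • (1 : Matrix (Fin 4) (Fin 4) ℂ) + ∑ β, w β • γ β) * γ ν)
      = 4 * (s * t * mink μ ν + ∑ α, ∑ β, v α * w β * ((mink μ α : ℂ) * mink ν β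
        - (mink α β : ℂ) * mink μ ν + (mink ν α : ℂ) * mink μ β)) := by
  simp only [add_mul, mul_add, Finset.sum_mul, Finset.mul_sum, smul_mul_assoc, mul_smul_comm,
    one_mul, mul_one, trace_add, trace_sum, trace_smul, trace_dirac_mul hγ,
    trace_dirac_mul_three hγ, trace_dirac_mul_four hγ, smul_eq_mul, mul_zero,
    Finset.sum_const_zero, add_zero, zero_add]
  rw [Finset.sum_comm]
  congr 1
  · ring
  · refine Finset.sum_congr rfl fun α _ => Finset.sum_congr rfl fun β _ => ?_
    rw [mink_comm α μ, mink_comm β ν, mink_comm α ν]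
    ring

end DiracTraces

/-- For Dirac matrices satisfying the hermiticity conditions `γ⁰ (γ^μ)† γ⁰ = γ^μ`, and
`Ψ = ψ I + Σ_μ ψ_μ γ^μ`, the Riesz tensor `T^{μν} = (1/4) tr(Ψ̄ γ^μ Ψ γ^ν)` is given by
`T^{μν} = (|ψ|² − η^{αβ} ψ*_α ψ_β) η^{μν} + ψ*^μ ψ^ν + ψ^μ ψ*^ν`; in particular it is
real and symmetric. -/
theorem riesz_tensor_formula
    (γ : Fin 4 → Matrix (Fin 4) (Fin 4) ℂ)
    (hClifford : ∀ μ ν, γ μ * γ ν + γ ν * γ μ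
      = (2 * (mink μ ν : ℂ)) • (1 : Matrix (Fin 4) (Fin 4) ℂ))
    (hHerm : ∀ μ, γ 0 * (γ μ)ᴴ * γ 0 = γ μ)
    (ψ : ℂ) (ψv : Fin 4 → ℂ)
    (Ψ : Matrix (Fin 4) (Fin 4) ℂ)
    (hΨ : Ψ = ψ • (1 : Matrix (Fin 4) (Fin 4) ℂ) + ∑ μ, ψv μ • γ μ)
    (Ψbar : Matrix (Fin 4) (Fin 4) ℂ)
    (hΨbar : Ψbar = γ 0 * Ψᴴ * γ 0)
    (ψup : Fin 4 → ℂ)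
    (hψup : ∀ μ, ψup μ = ∑ ν, (mink μ ν : ℂ) * ψv ν)
    (T : Fin 4 → Fin 4 → ℂ)
    (hT : ∀ μ ν, T μ ν = (1/4) * Matrix.trace (Ψbar * γ μ * Ψ * γ ν)) :
    (∀ μ ν, T μ ν =
        ((Complex.normSq ψ : ℂ)
            - ∑ α, ∑ β, (mink α β : ℂ) * (starRingEnd ℂ (ψv α)) * ψv β) * (mink μ ν : ℂ)
          + starRingEnd ℂ (ψup μ) * ψup ν + ψup μ * starRingEnd ℂ (ψup ν)) ∧
    (∀ μ ν, (T μ ν).im = 0) ∧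
    (∀ μ ν, T μ ν = T ν μ) := by
  have formula : ∀ μ ν, T μ ν =
        ((Complex.normSq ψ : ℂ)
            - ∑ α, ∑ β, (mink α β : ℂ) * (starRingEnd ℂ (ψv α)) * ψv β) * (mink μ ν : ℂ)
          + starRingEnd ℂ (ψup μ) * ψup ν + ψup μ * starRingEnd ℂ (ψup ν) := by
    intro μ ν
    rw [hT, hΨbar, hΨ, dirac_adjoint_eq hClifford hHerm, trace_dirac_sandwich hClifford,
      Complex.normSq_eq_conj_mul_self, hψup, hψup]
    simp only [map_add, map_mul, Complex.conj_ofReal, Fin.sum_univ_four]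
    ring
  have symm : ∀ μ ν, T μ ν = T ν μ := fun μ ν => by
    rw [formula μ ν, formula ν μ, mink_comm μ ν]
    ring
  refine ⟨formula, fun μ ν => ?_, symm⟩
  rw [← Complex.conj_eq_iff_im, formula μ ν]
  simp only [map_add, map_mul, map_sub, map_sum, Complex.conj_ofReal, Complex.conj_conj]
  have contraction : ∑ α, ∑ β, (mink α β : ℂ) * ψv α * starRingEnd ℂ (ψv β)
      = ∑ α, ∑ β, (mink α β : ℂ) * starRingEnd ℂ (ψv α) * ψv β := by
    rw [Finset.sum_comm]
    refine Finset.sum_congr rfl fun α _ => Finset.sum_congr rfl fun β _ => ?_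
    rw [mink_comm β α]
    ring
  rw [contraction]
  ring
end
end

section
/- Let u ∈ ℝ⁴ be a unit timelike future-directed vector (η(u,u) = 1 and u⁰ > 0), and let ρ, p be real numbers with ρ ≥ |p|. Define T^{μν} := ρ u^μ u^ν + p (η^{μν} − u^μ u^ν). Then for every future-directed causal vector Y ∈ ℝ⁴ (i.e. η(Y,Y) ≥ 0 and Y⁰ > 0), the vector Z^μ := Σ_ν T^{μν} Y_ν is causal and future-directed in the weak sense: η(Z,Z) ≥ 0 and Z⁰ ≥ 0. -/
noncomputable section

/-- The Minkowski bilinear form on `ℝ⁴`. -/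
def etaBil (v w : Fin 4 → ℝ) : ℝ := ∑ μ, ∑ ν, mink μ ν * v μ * w ν

theorem etaBil_eq (v w : Fin 4 → ℝ) :
    etaBil v w = v 0 * w 0 - v 1 * w 1 - v 2 * w 2 - v 3 * w 3 := by
  simp [etaBil, mink, Fin.sum_univ_four]
  ring

/-- A future-directed timelike vector pairs positively with a future-directed causal vector. -/
theorem etaBil_pos_of_timelike_of_causal {u Y : Fin 4 → ℝ} (hu : 0 < etaBil u u) (hu0 : 0 < u 0)
    (hY : 0 ≤ etaBil Y Y) (hY0 : 0 < Y 0) : 0 < etaBil u Y := by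
  rw [etaBil_eq] at *
  have hcs : (u 1 * Y 1 + u 2 * Y 2 + u 3 * Y 3) ^ 2 ≤
      (u 1 ^ 2 + u 2 ^ 2 + u 3 ^ 2) * (Y 1 ^ 2 + Y 2 ^ 2 + Y 3 ^ 2) := by
    nlinarith [sq_nonneg (u 1 * Y 2 - u 2 * Y 1), sq_nonneg (u 1 * Y 3 - u 3 * Y 1),
      sq_nonneg (u 2 * Y 3 - u 3 * Y 2)]
  have hlt : (u 1 ^ 2 + u 2 ^ 2 + u 3 ^ 2) * (Y 1 ^ 2 + Y 2 ^ 2 + Y 3 ^ 2) <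
      (u 0 * Y 0) ^ 2 :=
    calc
      _ ≤ (u 1 ^ 2 + u 2 ^ 2 + u 3 ^ 2) * Y 0 ^ 2 := by
        gcongr
        linarith
      _ < u 0 ^ 2 * Y 0 ^ 2 := by
        gcongr
        linarith
      _ = _ := by ring
  have := lt_of_pow_lt_pow_left₀ 2 (by positivity) (hcs.trans_lt hlt)
  linarith

/-- The time component of a causal vector pairing nonnegatively with a future-directed timelike
vector is nonnegative. -/
theorem time_nonneg_of_causal_of_etaBil_nonneg {u W : Fin 4 → ℝ} (hu : 0 < etaBil u u)
    (hu0 : 0 < u 0) (hW : 0 ≤ etaBil W W) (huW : 0 ≤ etaBil u W) : 0 ≤ W 0 := by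
  by_contra! h
  have hpos := etaBil_pos_of_timelike_of_causal (Y := -W) hu hu0
    (by simpa [etaBil_eq] using hW) (by simpa using h)
  simp only [etaBil_eq, Pi.neg_apply] at hpos huW
  linarith

/-- Dominant energy condition, part 1: for a perfect-fluid tensor
`T^{μν} = ρ u^μ u^ν + p (η^{μν} − u^μ u^ν)` with `u` unit timelike future-directed and
`ρ ≥ |p|`, the contraction `Z^μ = T^{μν} Y_ν` of `T` with any future-directed causal
vector `Y` is causal and future-directed in the weak sense. -/
theorem dominant_energy_condition_causal
    (u : Fin 4 → ℝ) (hu : etaBil u u = 1) (hu0 : 0 < u 0)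
    (ρ p : ℝ) (hρp : |p| ≤ ρ)
    (T : Fin 4 → Fin 4 → ℝ)
    (hT : ∀ μ ν, T μ ν = ρ * u μ * u ν + p * (mink μ ν - u μ * u ν))
    (Y : Fin 4 → ℝ) (hYcausal : 0 ≤ etaBil Y Y) (hYfut : 0 < Y 0)
    (Ylow : Fin 4 → ℝ) (hYlow : ∀ ν, Ylow ν = ∑ κ, mink ν κ * Y κ)
    (Z : Fin 4 → ℝ) (hZ : ∀ μ, Z μ = ∑ ν, T μ ν * Ylow ν) :
    0 ≤ etaBil Z Z ∧ 0 ≤ Z 0 := by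
  have hs := etaBil_pos_of_timelike_of_causal (by rw [hu]; exact one_pos) hu0 hYcausal hYfut
  set s := etaBil u Y with hs_def
  have hZ' : ∀ μ, Z μ = (ρ - p) * s * u μ + p * Y μ := by
    intro μ
    rw [hZ, hs_def, etaBil_eq]
    fin_cases μ <;> simp [hT, hYlow, mink, Fin.sum_univ_four] <;> ring
  have hZZ : etaBil Z Z = (ρ ^ 2 - p ^ 2) * s ^ 2 + p ^ 2 * etaBil Y Y := by
    have expand : etaBil Z Z = ((ρ - p) * s) ^ 2 * etaBil u u
        + 2 * p * ((ρ - p) * s) * etaBil u Y + p ^ 2 * etaBil Y Y := by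
      simp only [etaBil_eq, hZ']
      ring
    rw [expand, hu, ← hs_def]
    ring
  have hsq : p ^ 2 ≤ ρ ^ 2 := sq_le_sq.mpr (hρp.trans (le_abs_self ρ))
  obtain ⟨hneg, hle⟩ := abs_le.mp hρp
  refine ⟨?_, ?_⟩
  · rw [hZZ]
    have := sub_nonneg.mpr hsq
    positivity
  · rw [hZ']
    rcases le_total 0 p with hp | hp
    · have := sub_nonneg.mpr hle
      positivity
    · let W : Fin 4 → ℝ := fun μ => 2 * s * u μ - Y μ
      have hWW : etaBil W W = etaBil Y Y := by
        have expand : etaBil W W =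
            4 * s ^ 2 * etaBil u u - 4 * s * etaBil u Y + etaBil Y Y := by
          simp only [etaBil_eq, W]
          ring
        rw [expand, hu, ← hs_def]
        ring
      have huW : etaBil u W = s := by
        have expand : etaBil u W = 2 * s * etaBil u u - etaBil u Y := by
          simp only [etaBil_eq, W]
          ring
        rw [expand, hu, ← hs_def]
        ring
      have hW0 : 0 ≤ 2 * s * u 0 - Y 0 :=
        time_nonneg_of_causal_of_etaBil_nonneg (W := W) (by rw [hu]; exact one_pos) hu0
          (hWW ▸ hYcausal) (huW ▸ hs.le)
      have hsu : 0 ≤ (ρ + p) * (s * u 0) := mul_nonneg (by linarith) (by positivity)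
      have hpW := mul_nonneg (neg_nonneg.mpr hp) hW0
      linarith
end
end

section
/- Let λ > 0, let V : ℝⁿ → ℝ be smooth, and define the operator Ĥ acting in the q-variables by (Ĥ f)(x,q) := −(λ²/2) Δ_q f(x,q) + V(q) f(x,q). Suppose ψ : ℝ⁴ × ℝⁿ → ℂ and ψ₀,ψ₁,ψ₂,ψ₃ : ℝ⁴ × ℝⁿ → ℂ are smooth and satisfy, for all (x,q): (i) iλ ∂ψ/∂x^μ = Ĥ ψ_μ for every μ, and (ii) iλ Σ_{μ,ν} η^{μν} ∂ψ_ν/∂x^μ = Ĥ ψ. Then ψ satisfies the decoupled wave equation −λ² □ψ = Ĥ(Ĥψ), where □ := ∂²/∂(x⁰)² − ∂²/∂(x¹)² − ∂²/∂(x²)² − ∂²/∂(x³)² and Ĥ(Ĥψ) denotes the composition. -/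
noncomputable section

/-- Partial derivative in the spacetime variable `x^μ` of a `ℂ`-valued function on
`ℝ⁴ × ℝⁿ`. -/
def pdx {n : ℕ} (μ : Fin 4) (F : (Fin 4 → ℝ) → (Fin n → ℝ) → ℂ) :
    (Fin 4 → ℝ) → (Fin n → ℝ) → ℂ :=
  fun x q => fderiv ℝ (fun y => F y q) x (Pi.single μ 1)

/-- Partial derivative in the field-space variable `q^a` of a `ℂ`-valued function on
`ℝ⁴ × ℝⁿ`. -/
def pdq {n : ℕ} (a : Fin n) (F : (Fin 4 → ℝ) → (Fin n → ℝ) → ℂ) :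
    (Fin 4 → ℝ) → (Fin n → ℝ) → ℂ :=
  fun x q => fderiv ℝ (fun p => F x p) q (Pi.single a 1)

/-- The Euclidean Laplacian `Δ_q` in the `q`-variables. -/
def lapq {n : ℕ} (F : (Fin 4 → ℝ) → (Fin n → ℝ) → ℂ) :
    (Fin 4 → ℝ) → (Fin n → ℝ) → ℂ :=
  fun x q => ∑ a, pdq a (pdq a F) x q

/-- The Hamiltonian operator `Ĥ = −(λ²/2) Δ_q + V(q)` acting in the `q`-variables. -/
def Hop {n : ℕ} (lam : ℝ) (V : (Fin n → ℝ) → ℝ)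
    (F : (Fin 4 → ℝ) → (Fin n → ℝ) → ℂ) :
    (Fin 4 → ℝ) → (Fin n → ℝ) → ℂ :=
  fun x q => -((lam : ℂ) ^ 2 / 2) * lapq F x q + (V q : ℂ) * F x q

/-- The D'Alembertian `□ = ∂₀² − ∂₁² − ∂₂² − ∂₃²`. -/
def dAlembert {n : ℕ} (F : (Fin 4 → ℝ) → (Fin n → ℝ) → ℂ) :
    (Fin 4 → ℝ) → (Fin n → ℝ) → ℂ :=
  fun x q => pdx 0 (pdx 0 F) x q - pdx 1 (pdx 1 F) x q
    - pdx 2 (pdx 2 F) x q - pdx 3 (pdx 3 F) x q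

/-- Joint smoothness of a `ℂ`-valued function on `ℝ⁴ × ℝⁿ`. -/
def JointlySmooth {n : ℕ} (F : (Fin 4 → ℝ) → (Fin n → ℝ) → ℂ) : Prop :=
  ContDiff ℝ (⊤ : ℕ∞) (fun p : (Fin 4 → ℝ) × (Fin n → ℝ) => F p.1 p.2)

namespace JointlySmooth

variable {n : ℕ} {F : (Fin 4 → ℝ) → (Fin n → ℝ) → ℂ}

lemma differentiable (hF : JointlySmooth F) :
    Differentiable ℝ (fun p : (Fin 4 → ℝ) × (Fin n → ℝ) => F p.1 p.2) :=
  ContDiff.differentiable hF (by simp)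

lemma differentiable_left (hF : JointlySmooth F) (q : Fin n → ℝ) :
    Differentiable ℝ (fun y => F y q) :=
  hF.differentiable.comp (differentiable_id.prodMk (differentiable_const q))

lemma differentiable_right (hF : JointlySmooth F) (x : Fin 4 → ℝ) :
    Differentiable ℝ (fun p => F x p) :=
  hF.differentiable.comp ((differentiable_const x).prodMk differentiable_id)

lemma pdx_eq (hF : JointlySmooth F) (μ : Fin 4) (x : Fin 4 → ℝ) (q : Fin n → ℝ) :
    pdx μ F x q = fderiv ℝ (fun p : (Fin 4 → ℝ) × (Fin n → ℝ) => F p.1 p.2) (x, q)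
      (Pi.single μ 1, 0) := by
  have h : HasFDerivAt (fun y => F y q) _ x :=
    HasFDerivAt.comp (f := fun y => (y, q)) x (hF.differentiable (x, q)).hasFDerivAt
      (hasFDerivAt_prodMk_left x q)
  rw [pdx, h.fderiv]
  simp

lemma pdq_eq (hF : JointlySmooth F) (a : Fin n) (x : Fin 4 → ℝ) (q : Fin n → ℝ) :
    pdq a F x q = fderiv ℝ (fun p : (Fin 4 → ℝ) × (Fin n → ℝ) => F p.1 p.2) (x, q)
      (0, Pi.single a 1) := by
  have h : HasFDerivAt (fun p => F x p) _ q :=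
    HasFDerivAt.comp (f := fun p => (x, p)) q (hF.differentiable (x, q)).hasFDerivAt
      (hasFDerivAt_prodMk_right x q)
  rw [pdq, h.fderiv]
  simp

lemma contDiff_fderiv_apply (hF : JointlySmooth F) (v : (Fin 4 → ℝ) × (Fin n → ℝ)) :
    ContDiff ℝ (⊤ : ℕ∞) (fun p : (Fin 4 → ℝ) × (Fin n → ℝ) =>
      fderiv ℝ (fun p : (Fin 4 → ℝ) × (Fin n → ℝ) => F p.1 p.2) p v) :=
  (ContDiff.fderiv_right (m := (⊤ : ℕ∞)) hF (by simp)).clm_apply contDiff_const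

lemma smooth_pdx (hF : JointlySmooth F) (μ : Fin 4) : JointlySmooth (pdx μ F) := by
  simpa only [JointlySmooth, hF.pdx_eq] using hF.contDiff_fderiv_apply (Pi.single μ 1, 0)

lemma smooth_pdq (hF : JointlySmooth F) (a : Fin n) : JointlySmooth (pdq a F) := by
  simpa only [JointlySmooth, hF.pdq_eq] using hF.contDiff_fderiv_apply (0, Pi.single a 1)

lemma const_mul (hF : JointlySmooth F) (c : ℂ) : JointlySmooth (fun x q => c * F x q) :=
  ContDiff.mul contDiff_const hF

lemma sum {ι : Type*} {s : Finset ι} {F : ι → (Fin 4 → ℝ) → (Fin n → ℝ) → ℂ}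
    (hF : ∀ i ∈ s, JointlySmooth (F i)) : JointlySmooth (fun x q => ∑ i ∈ s, F i x q) :=
  ContDiff.sum hF

lemma smooth_lapq (hF : JointlySmooth F) : JointlySmooth (lapq F) :=
  sum fun a _ => (hF.smooth_pdq a).smooth_pdq a

/-- Spacetime and field-space partial derivatives of a smooth function commute. -/
lemma pdx_pdq_comm (hF : JointlySmooth F) (μ : Fin 4) (a : Fin n) :
    pdx μ (pdq a F) = pdq a (pdx μ F) := by
  funext x q
  have hd : DifferentiableAt ℝ
      (fderiv ℝ (fun p : (Fin 4 → ℝ) × (Fin n → ℝ) => F p.1 p.2)) (x, q) :=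
    (ContDiff.fderiv_right (m := (⊤ : ℕ∞)) hF (by simp)).differentiable (by simp) _
  have hs : IsSymmSndFDerivAt ℝ (fun p : (Fin 4 → ℝ) × (Fin n → ℝ) => F p.1 p.2) (x, q) :=
    (ContDiff.contDiffAt hF).isSymmSndFDerivAt
      (by rw [minSmoothness_of_isRCLikeNormedField]
          exact WithTop.coe_le_coe.2 (le_top (a := (2 : ℕ∞))))
  rw [(hF.smooth_pdq a).pdx_eq, (hF.smooth_pdx μ).pdq_eq]
  simp only [hF.pdq_eq, hF.pdx_eq, Prod.mk.eta]
  rw [fderiv_clm_apply hd (differentiableAt_const _),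
    fderiv_clm_apply hd (differentiableAt_const _)]
  simpa using hs.eq (Pi.single μ 1, 0) (0, Pi.single a 1)

lemma pdx_const_mul (hF : JointlySmooth F) (μ : Fin 4) (c : ℂ) :
    pdx μ (fun x q => c * F x q) = fun x q => c * pdx μ F x q := by
  funext x q
  simp [pdx, fderiv_const_mul (hF.differentiable_left q x)]

lemma pdq_const_mul (hF : JointlySmooth F) (a : Fin n) (c : ℂ) :
    pdq a (fun x q => c * F x q) = fun x q => c * pdq a F x q := by
  funext x q
  simp [pdq, fderiv_const_mul (hF.differentiable_right x q)]

lemma pdq_sum {ι : Type*} {s : Finset ι} {F : ι → (Fin 4 → ℝ) → (Fin n → ℝ) → ℂ}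
    (hF : ∀ i ∈ s, JointlySmooth (F i)) (a : Fin n) :
    pdq a (fun x q => ∑ i ∈ s, F i x q) = fun x q => ∑ i ∈ s, pdq a (F i) x q := by
  funext x q
  simp only [pdq]
  rw [fderiv_fun_sum fun i hi => (hF i hi).differentiable_right x q]
  simp

lemma pdx_sum {ι : Type*} {s : Finset ι} {F : ι → (Fin 4 → ℝ) → (Fin n → ℝ) → ℂ}
    (hF : ∀ i ∈ s, JointlySmooth (F i)) (μ : Fin 4) :
    pdx μ (fun x q => ∑ i ∈ s, F i x q) = fun x q => ∑ i ∈ s, pdx μ (F i) x q := by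
  funext x q
  simp only [pdx]
  rw [fderiv_fun_sum fun i hi => (hF i hi).differentiable_left q x]
  simp

lemma lapq_const_mul (hF : JointlySmooth F) (c : ℂ) :
    lapq (fun x q => c * F x q) = fun x q => c * lapq F x q := by
  funext x q
  simp only [lapq, Finset.mul_sum]
  refine Finset.sum_congr rfl fun a _ => ?_
  rw [hF.pdq_const_mul, (hF.smooth_pdq a).pdq_const_mul]

lemma lapq_sum {ι : Type*} {s : Finset ι} {F : ι → (Fin 4 → ℝ) → (Fin n → ℝ) → ℂ}
    (hF : ∀ i ∈ s, JointlySmooth (F i)) :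
    lapq (fun x q => ∑ i ∈ s, F i x q) = fun x q => ∑ i ∈ s, lapq (F i) x q := by
  funext x q
  simp only [lapq]
  rw [Finset.sum_comm]
  refine Finset.sum_congr rfl fun a _ => ?_
  rw [pdq_sum hF, pdq_sum fun i hi => (hF i hi).smooth_pdq a]

lemma pdx_lapq_comm (hF : JointlySmooth F) (μ : Fin 4) :
    pdx μ (lapq F) = lapq (pdx μ F) := by
  have h : lapq F = fun x q => ∑ a, pdq a (pdq a F) x q := rfl
  rw [h, pdx_sum fun a _ => (hF.smooth_pdq a).smooth_pdq a]
  funext x q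
  refine Finset.sum_congr rfl fun a _ => ?_
  rw [(hF.smooth_pdq a).pdx_pdq_comm, hF.pdx_pdq_comm]

lemma Hop_const_mul (hF : JointlySmooth F) (lam : ℝ) (V : (Fin n → ℝ) → ℝ) (c : ℂ) :
    Hop lam V (fun x q => c * F x q) = fun x q => c * Hop lam V F x q := by
  funext x q
  simp only [Hop, hF.lapq_const_mul]
  ring

lemma Hop_sum {ι : Type*} {s : Finset ι} {F : ι → (Fin 4 → ℝ) → (Fin n → ℝ) → ℂ}
    (hF : ∀ i ∈ s, JointlySmooth (F i)) (lam : ℝ) (V : (Fin n → ℝ) → ℝ) :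
    Hop lam V (fun x q => ∑ i ∈ s, F i x q) = fun x q => ∑ i ∈ s, Hop lam V (F i) x q := by
  funext x q
  simp only [Hop, lapq_sum hF, Finset.mul_sum, Finset.sum_add_distrib]

/-- The Hamiltonian, acting only in the field-space variables, commutes with spacetime
partial derivatives. -/
lemma pdx_Hop_comm (hF : JointlySmooth F) (lam : ℝ) (V : (Fin n → ℝ) → ℝ) (μ : Fin 4) :
    pdx μ (Hop lam V F) = Hop lam V (pdx μ F) := by
  funext x q
  have hl := hF.smooth_lapq.differentiable_left q x
  have hf := hF.differentiable_left q x
  have h : pdx μ (Hop lam V F) x q =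
      -((lam : ℂ) ^ 2 / 2) * pdx μ (lapq F) x q
        + (V q : ℂ) * pdx μ F x q := by
    simp only [pdx, Hop]
    rw [fderiv_fun_add (hl.const_mul _) (hf.const_mul _), fderiv_const_mul hl,
      fderiv_const_mul hf]
    simp
  rw [h, hF.pdx_lapq_comm, Hop]

end JointlySmooth

lemma sum_mink_mul_pdx_pdx {n : ℕ} (F : (Fin 4 → ℝ) → (Fin n → ℝ) → ℂ)
    (x : Fin 4 → ℝ) (q : Fin n → ℝ) :
    ∑ μ, ∑ ν, ((mink μ ν : ℝ) : ℂ) * pdx μ (pdx ν F) x q = dAlembert F x q := by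
  simp [mink, dAlembert, Fin.sum_univ_four]
  ring

/-- If `(ψ, ψ_μ)` is a smooth solution of the Kanatchikov system
`iλ ∂_μ ψ = Ĥ ψ_μ`, `iλ η^{μν} ∂_μ ψ_ν = Ĥ ψ`, then `ψ` satisfies the decoupled
wave equation `−λ² □ψ = Ĥ(Ĥψ)`. -/
theorem kanatchikov_decoupled_wave_equation {n : ℕ}
    (lam : ℝ) (hlam : 0 < lam)
    (V : (Fin n → ℝ) → ℝ) (hV : ContDiff ℝ (⊤ : ℕ∞) V)
    (ψ : (Fin 4 → ℝ) → (Fin n → ℝ) → ℂ)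
    (ψv : Fin 4 → (Fin 4 → ℝ) → (Fin n → ℝ) → ℂ)
    (hψ : ContDiff ℝ (⊤ : ℕ∞) (fun p : (Fin 4 → ℝ) × (Fin n → ℝ) => ψ p.1 p.2))
    (hψv : ∀ μ, ContDiff ℝ (⊤ : ℕ∞) (fun p : (Fin 4 → ℝ) × (Fin n → ℝ) => ψv μ p.1 p.2))
    (h1 : ∀ μ x q, Complex.I * (lam : ℂ) * pdx μ ψ x q = Hop lam V (ψv μ) x q)
    (h2 : ∀ x q, Complex.I * (lam : ℂ)
        * ∑ μ, ∑ ν, ((mink μ ν : ℝ) : ℂ) * pdx μ (ψv ν) x q = Hop lam V ψ x q) :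
    ∀ x q, -(lam : ℂ) ^ 2 * dAlembert ψ x q = Hop lam V (Hop lam V ψ) x q := by
  intro x q
  replace hψ : JointlySmooth ψ := hψ
  replace hψv : ∀ μ, JointlySmooth (ψv μ) := hψv
  have hHψ : Hop lam V ψ = fun x q => Complex.I * (lam : ℂ)
      * ∑ μ, ∑ ν, ((mink μ ν : ℝ) : ℂ) * pdx μ (ψv ν) x q := by
    funext x q
    exact (h2 x q).symm
  have hHψv : ∀ ν, Hop lam V (ψv ν) = fun x q => Complex.I * (lam : ℂ) * pdx ν ψ x q := by
    intro ν
    funext x q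
    exact (h1 ν x q).symm
  have hterm : ∀ μ ν, JointlySmooth fun x q => ((mink μ ν : ℝ) : ℂ) * pdx μ (ψv ν) x q :=
    fun μ ν => ((hψv ν).smooth_pdx μ).const_mul _
  have hrow : ∀ μ, JointlySmooth fun x q => ∑ ν, ((mink μ ν : ℝ) : ℂ) * pdx μ (ψv ν) x q :=
    fun μ => JointlySmooth.sum fun ν _ => hterm μ ν
  have hentry : ∀ μ ν, Hop lam V (fun x q => ((mink μ ν : ℝ) : ℂ) * pdx μ (ψv ν) x q) x q =
      Complex.I * (lam : ℂ) * (((mink μ ν : ℝ) : ℂ) * pdx μ (pdx ν ψ) x q) := by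
    intro μ ν
    rw [((hψv ν).smooth_pdx μ).Hop_const_mul, ← (hψv ν).pdx_Hop_comm, hHψv ν,
      (hψ.smooth_pdx ν).pdx_const_mul]
    ring
  rw [hHψ, (JointlySmooth.sum fun μ _ => hrow μ).Hop_const_mul,
    JointlySmooth.Hop_sum fun μ _ => hrow μ]
  have hsum : ∀ μ, Hop lam V (fun x q => ∑ ν, ((mink μ ν : ℝ) : ℂ) * pdx μ (ψv ν) x q) x q =
      ∑ ν, Complex.I * (lam : ℂ) * (((mink μ ν : ℝ) : ℂ) * pdx μ (pdx ν ψ) x q) := by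
    intro μ
    rw [JointlySmooth.Hop_sum fun ν _ => hterm μ ν]
    exact Finset.sum_congr rfl fun ν _ => hentry μ ν
  simp only [hsum, ← Finset.mul_sum, sum_mink_mul_pdx_pdx]
  linear_combination (-(lam : ℂ) ^ 2 * dAlembert ψ x q) * Complex.I_sq
end
end

section
/- Let γ⁰,γ¹,γ²,γ³ be Dirac matrices satisfying in addition the hermiticity conditions γ⁰ (γ^μ)† γ⁰ = γ^μ for all μ. Let λ ≠ 0 be real, let V : ℝⁿ → ℝ be smooth, and let Ψ : ℝ⁴ × ℝⁿ → M₄(ℂ) be a smooth matrix-valued function satisfying Kanatchikov's equation iλ Σ_μ γ^μ ∂Ψ/∂x^μ = −(λ²/2) Δ_q Ψ + V(q) Ψ. Define T^{μν}(x,q) := (1/4) tr( Ψ̄ γ^μ Ψ γ^ν ) and K^{aν}(x,q) := (λ/(2i)) (1/4) tr( ( Ψ̄ ∂Ψ/∂q^a − (∂Ψ̄/∂q^a) Ψ ) γ^ν ). Then for each ν = 0,1,2,3 the conservation law Σ_{μ=0}^{3} ∂T^{μν}/∂x^μ + Σ_{a=1}^{n} ∂K^{aν}/∂q^a = 0 holds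 everywhere. -/
open Matrix
noncomputable section

/-- Entrywise partial derivative in `x^μ` of a matrix-valued function on `ℝ⁴ × ℝⁿ`. -/
def pdxM {n : ℕ} (μ : Fin 4) (F : (Fin 4 → ℝ) → (Fin n → ℝ) → Matrix (Fin 4) (Fin 4) ℂ) :
    (Fin 4 → ℝ) → (Fin n → ℝ) → Matrix (Fin 4) (Fin 4) ℂ :=
  fun x q i j => fderiv ℝ (fun y => F y q i j) x (Pi.single μ 1)

/-- Entrywise partial derivative in `q^a` of a matrix-valued function on `ℝ⁴ × ℝⁿ`. -/
def pdqM {n : ℕ} (a : Fin n) (F : (Fin 4 → ℝ) → (Fin n → ℝ) → Matrix (Fin 4) (Fin 4) ℂ) :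
    (Fin 4 → ℝ) → (Fin n → ℝ) → Matrix (Fin 4) (Fin 4) ℂ :=
  fun x q i j => fderiv ℝ (fun p => F x p i j) q (Pi.single a 1)

/-- Partial derivative in `x^μ` of a `ℂ`-valued function on `ℝ⁴ × ℝⁿ`. -/
def pdxC {n : ℕ} (μ : Fin 4) (F : (Fin 4 → ℝ) → (Fin n → ℝ) → ℂ) :
    (Fin 4 → ℝ) → (Fin n → ℝ) → ℂ :=
  fun x q => fderiv ℝ (fun y => F y q) x (Pi.single μ 1)

/-- Partial derivative in `q^a` of a `ℂ`-valued function on `ℝ⁴ × ℝⁿ`. -/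
def pdqC {n : ℕ} (a : Fin n) (F : (Fin 4 → ℝ) → (Fin n → ℝ) → ℂ) :
    (Fin 4 → ℝ) → (Fin n → ℝ) → ℂ :=
  fun x q => fderiv ℝ (fun p => F x p) q (Pi.single a 1)

section EntrywiseDerivative

variable {E : Type*} [NormedAddCommGroup E] [NormedSpace ℝ E]

/-- The entries of `F` are differentiable at `x`, with derivatives along `v` the entries of `F'`. -/
def HasEntrywiseDeriv {m k : Type*} (F : E → Matrix m k ℂ) (F' : Matrix m k ℂ) (x v : E) : Prop :=
  ∀ i j, ∃ L : E →L[ℝ] ℂ, HasFDerivAt (fun y => F y i j) L x ∧ L v = F' i j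

namespace HasEntrywiseDeriv

variable {l m k : Type*} {x v : E}

theorem const (A : Matrix m k ℂ) : HasEntrywiseDeriv (fun _ : E => A) 0 x v :=
  fun i j => ⟨0, hasFDerivAt_const (A i j) x, rfl⟩

theorem sub {F G : E → Matrix m k ℂ} {F' G' : Matrix m k ℂ}
    (hF : HasEntrywiseDeriv F F' x v) (hG : HasEntrywiseDeriv G G' x v) :
    HasEntrywiseDeriv (fun y => F y - G y) (F' - G') x v := by
  intro i j
  obtain ⟨L, hL, hLv⟩ := hF i j
  obtain ⟨M, hM, hMv⟩ := hG i j
  exact ⟨L - M, hL.sub hM, by simp [hLv, hMv]⟩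

theorem mul [Fintype m] {F : E → Matrix l m ℂ} {G : E → Matrix m k ℂ}
    {F' : Matrix l m ℂ} {G' : Matrix m k ℂ}
    (hF : HasEntrywiseDeriv F F' x v) (hG : HasEntrywiseDeriv G G' x v) :
    HasEntrywiseDeriv (fun y => F y * G y) (F' * G x + F x * G') x v := by
  intro i j
  choose L hL hLv using hF
  choose M hM hMv using hG
  refine ⟨∑ s, (F x i s • M s j + G x s j • L i s), ?_, ?_⟩
  · simp only [Matrix.mul_apply]
    exact HasFDerivAt.fun_sum fun s _ => (hL i s).mul (hM s j)
  · simp [Matrix.mul_apply, hLv, hMv, Finset.sum_add_distrib, mul_comm, add_comm]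

theorem conjTranspose {F : E → Matrix m k ℂ} {F' : Matrix m k ℂ}
    (hF : HasEntrywiseDeriv F F' x v) :
    HasEntrywiseDeriv (fun y => (F y)ᴴ) F'ᴴ x v := by
  intro i j
  obtain ⟨L, hL, hLv⟩ := hF j i
  exact ⟨_, hL.star, by simp [hLv]⟩

theorem fderiv_apply {F : E → Matrix m k ℂ} {F' : Matrix m k ℂ}
    (hF : HasEntrywiseDeriv F F' x v) (i : m) (j : k) :
    fderiv ℝ (fun y => F y i j) x v = F' i j := by
  obtain ⟨L, hL, hLv⟩ := hF i j
  rw [hL.fderiv, hLv]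

theorem fderiv_const_mul_trace [Fintype m] {F : E → Matrix m m ℂ} {F' : Matrix m m ℂ}
    (hF : HasEntrywiseDeriv F F' x v) (c : ℂ) :
    fderiv ℝ (fun y => c * (F y).trace) x v = c * F'.trace := by
  choose L hL hLv using hF
  have h : HasFDerivAt (fun y => c * (F y).trace) (c • ∑ i, L i i) x :=
    (HasFDerivAt.fun_sum fun i _ => hL i i).const_mul c
  rw [h.fderiv]
  simp [hLv, Matrix.trace]

end HasEntrywiseDeriv

end EntrywiseDerivative

section PartialDerivatives

variable {n : ℕ} {Ψ : (Fin 4 → ℝ) → (Fin n → ℝ) → Matrix (Fin 4) (Fin 4) ℂ}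

theorem hasEntrywiseDeriv_pdxM {x : Fin 4 → ℝ} {q : Fin n → ℝ}
    (hΨ : ∀ i j, DifferentiableAt ℝ (fun y => Ψ y q i j) x) (μ : Fin 4) :
    HasEntrywiseDeriv (fun y => Ψ y q) (pdxM μ Ψ x q) x (Pi.single μ 1) :=
  fun i j => ⟨_, (hΨ i j).hasFDerivAt, rfl⟩

theorem hasEntrywiseDeriv_pdqM {x : Fin 4 → ℝ} {q : Fin n → ℝ}
    (hΨ : ∀ i j, DifferentiableAt ℝ (fun p => Ψ x p i j) q) (a : Fin n) :
    HasEntrywiseDeriv (fun p => Ψ x p) (pdqM a Ψ x q) q (Pi.single a 1) :=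
  fun i j => ⟨_, (hΨ i j).hasFDerivAt, rfl⟩

theorem contDiff_pdqM {x : Fin 4 → ℝ}
    (hΨ : ∀ i j, ContDiff ℝ (⊤ : ℕ∞) (fun p => Ψ x p i j)) (a : Fin n) (i j : Fin 4) :
    ContDiff ℝ (⊤ : ℕ∞) (fun p => pdqM a Ψ x p i j) :=
  ((hΨ i j).fderiv_right le_rfl).clm_apply contDiff_const

end PartialDerivatives

/-- The Dirac adjoint `g Aᴴ g` reverses products when `g` squares to the identity. -/
theorem diracAdjoint_mul {m : Type*} [Fintype m] [DecidableEq m] {g : Matrix m m ℂ}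
    (hg : g * g = 1) (A B : Matrix m m ℂ) :
    g * (A * B)ᴴ * g = (g * Bᴴ * g) * (g * Aᴴ * g) := by
  rw [conjTranspose_mul]
  calc g * (Bᴴ * Aᴴ) * g = g * Bᴴ * 1 * Aᴴ * g := by simp only [Matrix.mul_one, Matrix.mul_assoc]
    _ = _ := by rw [← hg]; simp only [Matrix.mul_assoc]

/-- For a smooth solution `Ψ` of Kanatchikov's equation
`iλ γ^μ ∂_μ Ψ = −(λ²/2) Δ_q Ψ + V(q) Ψ` (with Dirac matrices satisfying the hermiticity
conditions), the Riesz tensor `T^{μν} = (1/4) tr(Ψ̄ γ^μ Ψ γ^ν)` and the current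
`K^{aν} = (λ/2i)(1/4) tr((Ψ̄ ∂_a Ψ − (∂_a Ψ̄) Ψ) γ^ν)` satisfy the conservation laws
`∂_μ T^{μν} + ∂_a K^{aν} = 0` for each `ν`. -/
theorem riesz_conservation_law {n : ℕ}
    (γ : Fin 4 → Matrix (Fin 4) (Fin 4) ℂ)
    (hClifford : ∀ μ ν, γ μ * γ ν + γ ν * γ μ
      = (2 * (mink μ ν : ℂ)) • (1 : Matrix (Fin 4) (Fin 4) ℂ))
    (hHerm : ∀ μ, γ 0 * (γ μ)ᴴ * γ 0 = γ μ)
    (lam : ℝ) (hlam : lam ≠ 0)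
    (V : (Fin n → ℝ) → ℝ) (hV : ContDiff ℝ (⊤ : ℕ∞) V)
    (Ψ : (Fin 4 → ℝ) → (Fin n → ℝ) → Matrix (Fin 4) (Fin 4) ℂ)
    (hΨsmooth : ∀ i j, ContDiff ℝ (⊤ : ℕ∞)
      (fun p : (Fin 4 → ℝ) × (Fin n → ℝ) => Ψ p.1 p.2 i j))
    (hKanat : ∀ x q, (Complex.I * (lam : ℂ)) • (∑ μ, γ μ * pdxM μ Ψ x q)
        = (-((lam : ℂ) ^ 2 / 2)) • (∑ a, pdqM a (pdqM a Ψ) x q) + ((V q : ℝ) : ℂ) • Ψ x q)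
    (Ψbar : (Fin 4 → ℝ) → (Fin n → ℝ) → Matrix (Fin 4) (Fin 4) ℂ)
    (hΨbar : ∀ x q, Ψbar x q = γ 0 * (Ψ x q)ᴴ * γ 0)
    (T : Fin 4 → Fin 4 → (Fin 4 → ℝ) → (Fin n → ℝ) → ℂ)
    (hT : ∀ μ ν x q, T μ ν x q
        = (1/4) * Matrix.trace (Ψbar x q * γ μ * Ψ x q * γ ν))
    (K : Fin n → Fin 4 → (Fin 4 → ℝ) → (Fin n → ℝ) → ℂ)
    (hK : ∀ a ν x q, K a ν x q
        = ((lam : ℂ) / (2 * Complex.I)) * ((1/4) * Matrix.trace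
            ((Ψbar x q * pdqM a Ψ x q - pdqM a Ψbar x q * Ψ x q) * γ ν))) :
    ∀ ν x q, (∑ μ, pdxC μ (T μ ν) x q) + (∑ a, pdqC a (K a ν) x q) = 0 := by
  intro ν x q
  have hsq : γ 0 * γ 0 = 1 := by
    have h := hClifford 0 0
    simp only [mink, if_true, Complex.ofReal_one, mul_one, ← two_smul ℂ (γ 0 * γ 0)] at h
    exact smul_right_injective _ (two_ne_zero (α := ℂ)) h
  have hx : ∀ q i j, ContDiff ℝ (⊤ : ℕ∞) (fun y => Ψ y q i j) := fun q i j =>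
    (hΨsmooth i j).comp (contDiff_id.prodMk contDiff_const)
  have hq : ∀ i j, ContDiff ℝ (⊤ : ℕ∞) (fun p => Ψ x p i j) := fun i j =>
    (hΨsmooth i j).comp (contDiff_const.prodMk contDiff_id)
  have htop : ((⊤ : ℕ∞) : WithTop ℕ∞) ≠ 0 := by simp
  have adj {E : Type} [NormedAddCommGroup E] [NormedSpace ℝ E]
      {F : E → Matrix (Fin 4) (Fin 4) ℂ} {F' : Matrix (Fin 4) (Fin 4) ℂ} {y v : E}
      (hF : HasEntrywiseDeriv F F' y v) :
      HasEntrywiseDeriv (fun z => γ 0 * (F z)ᴴ * γ 0) (γ 0 * F'ᴴ * γ 0) y v := by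
    simpa using ((HasEntrywiseDeriv.const (γ 0)).mul hF.conjTranspose).mul
      (HasEntrywiseDeriv.const (γ 0))
  have hΨq : ∀ p a, HasEntrywiseDeriv (fun p => Ψ x p) (pdqM a Ψ x p) p (Pi.single a 1) :=
    fun p a => hasEntrywiseDeriv_pdqM (fun i j => (hq i j).differentiable htop p) a
  have hbarq : ∀ p a, pdqM a Ψbar x p = γ 0 * (pdqM a Ψ x p)ᴴ * γ 0 := by
    intro p a
    ext i j
    simp only [pdqM, hΨbar]
    exact (adj (hΨq p a)).fderiv_apply i j
  have hTderiv : ∀ μ, pdxC μ (T μ ν) x q = (1/4) * Matrix.trace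
      ((γ 0 * (γ μ * pdxM μ Ψ x q)ᴴ * γ 0 * Ψ x q
        + γ 0 * (Ψ x q)ᴴ * γ 0 * (γ μ * pdxM μ Ψ x q)) * γ ν) := by
    intro μ
    have hΨx := hasEntrywiseDeriv_pdxM (fun i j => (hx q i j).differentiable htop x) μ
    have h := ((((adj hΨx).mul (.const (γ μ))).mul hΨx).mul
      (.const (γ ν))).fderiv_const_mul_trace (1/4)
    simp only [pdxC, hT, hΨbar]
    rw [h, diracAdjoint_mul hsq, hHerm]
    simp only [Matrix.mul_zero, add_zero, Matrix.mul_assoc]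
  have hKderiv : ∀ a, pdqC a (K a ν) x q = (lam : ℂ) / (2 * Complex.I) * (1/4) * Matrix.trace
      ((γ 0 * (Ψ x q)ᴴ * γ 0 * pdqM a (pdqM a Ψ) x q
        - γ 0 * (pdqM a (pdqM a Ψ) x q)ᴴ * γ 0 * Ψ x q) * γ ν) := by
    intro a
    have hD : HasEntrywiseDeriv (fun p => pdqM a Ψ x p) (pdqM a (pdqM a Ψ) x q) q
        (Pi.single a 1) :=
      hasEntrywiseDeriv_pdqM (fun i j => (contDiff_pdqM hq a i j).differentiable htop q) a
    have h := (((((adj (hΨq q a)).mul hD).sub ((adj hD).mul (hΨq q a))).mul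
      (.const (γ ν))).fderiv_const_mul_trace ((lam : ℂ) / (2 * Complex.I) * (1/4)))
    simp only [pdqC, hK, hΨbar, hbarq, ← mul_assoc ((lam : ℂ) / (2 * Complex.I))]
    rw [h, Matrix.mul_zero, add_zero]
    congr 3
    abel
  set S := ∑ μ, γ μ * pdxM μ Ψ x q with hS
  set L := ∑ a, pdqM a (pdqM a Ψ) x q with hL
  have hsumT : ∑ μ, pdxC μ (T μ ν) x q = (1/4) * Matrix.trace
      ((γ 0 * Sᴴ * γ 0 * Ψ x q + γ 0 * (Ψ x q)ᴴ * γ 0 * S) * γ ν) := by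
    simp only [hTderiv, hS, ← Finset.mul_sum, ← Matrix.trace_sum, ← Finset.sum_mul,
      Finset.sum_add_distrib, conjTranspose_sum]
  have hsumK : ∑ a, pdqC a (K a ν) x q = (lam : ℂ) / (2 * Complex.I) * (1/4) * Matrix.trace
      ((γ 0 * (Ψ x q)ᴴ * γ 0 * L - γ 0 * Lᴴ * γ 0 * Ψ x q) * γ ν) := by
    simp only [hKderiv, hL, ← Finset.mul_sum, ← Matrix.trace_sum, ← Finset.sum_mul,
      Finset.sum_sub_distrib, conjTranspose_sum]
  have hlam' : (lam : ℂ) ≠ 0 := by exact_mod_cast hlam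
  have hSeq : S = (Complex.I * lam / 2) • L + (-(Complex.I * V q / lam)) • Ψ x q := by
    have h := congrArg (fun A => (Complex.I * (lam : ℂ))⁻¹ • A) (hKanat x q)
    simp only [smul_add, smul_smul] at h
    rw [inv_mul_cancel₀ (mul_ne_zero Complex.I_ne_zero hlam'), one_smul] at h
    rw [hS, h]
    congr 2 <;> simp only [mul_inv, Complex.inv_I] <;> field_simp
  have hSH : Sᴴ = (-(Complex.I * lam / 2)) • Lᴴ + (Complex.I * V q / lam) • (Ψ x q)ᴴ := by
    rw [hSeq]
    simp [conjTranspose_add, conjTranspose_smul, neg_div]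
  rw [hsumT, hsumK, hSH, hSeq]
  simp only [Matrix.mul_add, Matrix.add_mul, Matrix.sub_mul, Matrix.mul_smul, Matrix.smul_mul,
    Matrix.trace_add, Matrix.trace_sub, Matrix.trace_smul, smul_eq_mul, div_eq_mul_inv, mul_inv,
    Complex.inv_I]
  ring
end
end

section
/- Let ω > 0, B₀, σ₀ ∈ ℝ, let f(σ,q) := −(ω/2)(B₀²/ω² + q²) tan(ω(σ−σ₀)) + B₀ q sec(ω(σ−σ₀)), and let g₀ : ℝ → ℝ be continuously differentiable. Define g(σ,q) := g₀( q sec(ω(σ−σ₀)) − (B₀/ω) tan(ω(σ−σ₀)) ) · sec(ω(σ−σ₀)). Then at every point (σ,q) with cos(ω(σ−σ₀)) ≠ 0, g satisfies the continuity equation ∂g/∂σ + ∂/∂q ( g · ∂f/∂q ) = 0, and g(σ₀,q) = g₀(q). -/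
noncomputable section

/-- With `f(σ,q) = −(ω/2)(B₀²/ω² + q²) tan(ω(σ−σ₀)) + B₀ q sec(ω(σ−σ₀))` and
`g(σ,q) = g₀(q sec(ω(σ−σ₀)) − (B₀/ω) tan(ω(σ−σ₀))) sec(ω(σ−σ₀))` for a `C¹` function
`g₀`, the continuity equation `∂_σ g + ∂_q(g ∂_q f) = 0` holds wherever
`cos(ω(σ−σ₀)) ≠ 0`, and `g(σ₀,q) = g₀(q)`. -/
theorem harmonic_oscillator_continuity_solution
    (ω B₀ σ₀ : ℝ) (hω : 0 < ω)
    (g₀ : ℝ → ℝ) (hg₀ : ContDiff ℝ 1 g₀)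
    (f : ℝ → ℝ → ℝ)
    (hf : ∀ σ q, f σ q = -(ω / 2) * (B₀ ^ 2 / ω ^ 2 + q ^ 2) * Real.tan (ω * (σ - σ₀))
        + B₀ * q * (Real.cos (ω * (σ - σ₀)))⁻¹)
    (g : ℝ → ℝ → ℝ)
    (hg : ∀ σ q, g σ q = g₀ (q * (Real.cos (ω * (σ - σ₀)))⁻¹
          - (B₀ / ω) * Real.tan (ω * (σ - σ₀)))
        * (Real.cos (ω * (σ - σ₀)))⁻¹) :
    (∀ σ q, Real.cos (ω * (σ - σ₀)) ≠ 0 →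
      deriv (fun s => g s q) σ
        + deriv (fun p => g σ p * deriv (fun r => f σ r) p) q = 0) ∧
    (∀ q, g σ₀ q = g₀ q) := by
  refine ⟨fun σ q hc => ?_, fun q => by simp [hg]⟩
  have hg₀' : ∀ x, HasDerivAt g₀ (deriv g₀ x) x := fun x =>
    (hg₀.differentiable one_ne_zero x).hasDerivAt
  have hlin : HasDerivAt (fun s => ω * (s - σ₀)) ω σ := by
    simpa using ((hasDerivAt_id σ).sub_const σ₀).const_mul ω
  have hsec := hlin.cos.fun_inv hc
  have htan := (Real.hasDerivAt_tan hc).comp σ hlin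
  have hg_time := ((hg₀' _).comp σ
    ((hsec.const_mul q).sub (htan.const_mul (B₀ / ω)))).mul hsec
  have hf_space : ∀ p, deriv (fun r => f σ r) p =
      -ω * p * Real.tan (ω * (σ - σ₀)) + B₀ * (Real.cos (ω * (σ - σ₀)))⁻¹ := by
    intro p
    simp only [hf]
    have h := ((((hasDerivAt_id p).pow 2).const_add (B₀ ^ 2 / ω ^ 2)).const_mul
      (-(ω / 2))).mul_const (Real.tan (ω * (σ - σ₀)))
    have h' := ((hasDerivAt_id p).const_mul B₀).mul_const (Real.cos (ω * (σ - σ₀)))⁻¹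
    refine ((h.add h').congr_deriv ?_).deriv
    simp only [id]
    push_cast
    ring
  have harg := ((hasDerivAt_id q).mul_const (Real.cos (ω * (σ - σ₀)))⁻¹).sub_const
    (B₀ / ω * Real.tan (ω * (σ - σ₀)))
  have hvel := (((hasDerivAt_id q).const_mul (-ω)).mul_const
    (Real.tan (ω * (σ - σ₀)))).add_const (B₀ * (Real.cos (ω * (σ - σ₀)))⁻¹)
  have hflux := (((hg₀' _).comp q harg).mul_const (Real.cos (ω * (σ - σ₀)))⁻¹).mul hvel
  simp only [hf_space, hg]
  refine (congrArg₂ (· + ·) hg_time.deriv hflux.deriv).trans ?_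
  simp only [Function.comp_apply, Pi.sub_apply, id, Real.tan_eq_sin_div_cos]
  field_simp
  ring
end
end

section
/- Let λ > 0, ω > 0, q₀ ∈ ℝ, and define on ℝ × ℝ: f(σ,q) := −(λ/2) ω σ − (ω/2) ( 2 q q₀ sin(ωσ) − (1/2) q₀² sin(2ωσ) ) and g(σ,q) := (2π·(λ/(2ω)))^{−1/2} exp( −(q − q₀ cos(ωσ))² / (2·(λ/(2ω))) ). Then g > 0 everywhere and (f,g) solves the quantum plane-wave equations with harmonic potential V(q) = (1/2) ω² q²: ∂f/∂σ + (1/2)(∂f/∂q)² + (1/2) ω² q² − (λ²/2) (∂²√g/∂q²)/√g = 0 and ∂g/∂σ + ∂/∂q ( g ∂f/∂q ) = 0. -/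
noncomputable section

/-- The derivative of a scaled Gaussian profile along a differentiable displacement. -/
theorem hasDerivAt_mul_exp_neg_sq {u : ℝ → ℝ} {u' x : ℝ} (A a : ℝ) (hu : HasDerivAt u u' x) :
    HasDerivAt (fun t => A * Real.exp (-a * u t ^ 2))
      (A * Real.exp (-a * u x ^ 2) * (-2 * a * u x * u')) x := by
  refine (((hu.pow 2).const_mul (-a)).exp.const_mul A).congr_deriv ?_
  simp only [Pi.pow_apply]
  push_cast
  ring

/-- The second derivative of the Gaussian `A * exp (-a * (r - c) ^ 2)`. -/
theorem deriv_deriv_mul_exp_neg_sq (A a c q : ℝ) :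
    deriv (fun p => deriv (fun r => A * Real.exp (-a * (r - c) ^ 2)) p) q
      = A * Real.exp (-a * (q - c) ^ 2) * (4 * a ^ 2 * (q - c) ^ 2 - 2 * a) := by
  have hlin : ∀ p, HasDerivAt (fun r : ℝ => r - c) 1 p := fun p => (hasDerivAt_id p).sub_const c
  have h : ∀ p, HasDerivAt (fun r => A * Real.exp (-a * (r - c) ^ 2)) _ p :=
    fun p => hasDerivAt_mul_exp_neg_sq A a (hlin p)
  simp only [fun p => (h p).deriv]
  refine ((h q).mul (((hlin q).const_mul (-2 * a)).mul_const 1)).deriv.trans ?_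
  ring

theorem sqrt_mul_exp_neg_sq {A : ℝ} (hA : 0 ≤ A) (a x : ℝ) :
    Real.sqrt (A * Real.exp (-a * x ^ 2)) = Real.sqrt A * Real.exp (-(a / 2) * x ^ 2) := by
  rw [Real.sqrt_mul hA, ← Real.exp_half]
  ring_nf

/-- The Gaussian wave-packet pair
`f(σ,q) = −(λ/2)ωσ − (ω/2)(2qq₀ sin(ωσ) − (1/2)q₀² sin(2ωσ))`,
`g(σ,q) = (2π(λ/2ω))^{-1/2} exp(−(q − q₀ cos(ωσ))²/(2(λ/2ω)))`
has `g > 0` and solves the quantum plane-wave Hamilton–Jacobi and continuity equations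
with harmonic potential `V(q) = (1/2)ω²q²`. -/
theorem gaussian_wave_packet_solution
    (lam ω q₀ : ℝ) (hlam : 0 < lam) (hω : 0 < ω)
    (f g : ℝ → ℝ → ℝ)
    (hf : ∀ σ q, f σ q = -(lam / 2) * ω * σ
        - (ω / 2) * (2 * q * q₀ * Real.sin (ω * σ)
            - (1/2) * q₀ ^ 2 * Real.sin (2 * ω * σ)))
    (hg : ∀ σ q, g σ q = (Real.sqrt (2 * Real.pi * (lam / (2 * ω))))⁻¹
        * Real.exp (-(q - q₀ * Real.cos (ω * σ)) ^ 2 / (2 * (lam / (2 * ω))))) :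
    (∀ σ q, 0 < g σ q) ∧
    (∀ σ q, deriv (fun s => f s q) σ + (1/2) * (deriv (fun p => f σ p) q) ^ 2
        + (1/2) * ω ^ 2 * q ^ 2
        - (lam ^ 2 / 2)
          * (deriv (fun p => deriv (fun r => Real.sqrt (g σ r)) p) q
              / Real.sqrt (g σ q)) = 0) ∧
    (∀ σ q, deriv (fun s => g s q) σ
        + deriv (fun p => g σ p * deriv (fun r => f σ r) p) q = 0) := by
  have hA : 0 < (Real.sqrt (2 * Real.pi * (lam / (2 * ω))))⁻¹ := by positivity
  set A := (Real.sqrt (2 * Real.pi * (lam / (2 * ω))))⁻¹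
  have hg' : ∀ σ q, g σ q = A * Real.exp (-(ω / lam) * (q - q₀ * Real.cos (ω * σ)) ^ 2) := by
    intro σ q
    rw [hg]
    congr 2
    field_simp
  have hfq : ∀ σ q, HasDerivAt (fun p => f σ p) (-ω * q₀ * Real.sin (ω * σ)) q := by
    intro σ q
    simp only [hf]
    refine (((((((hasDerivAt_id q).const_mul 2).mul_const q₀).mul_const
      (Real.sin (ω * σ))).sub_const _).const_mul (ω / 2)).const_sub _).congr_deriv ?_
    ring
  have hfσ : ∀ σ q, HasDerivAt (fun s => f s q) (-(lam / 2) * ω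
      - (ω / 2) * (2 * q * q₀ * (Real.cos (ω * σ) * ω)
        - (1/2) * q₀ ^ 2 * (Real.cos (2 * ω * σ) * (2 * ω)))) σ := by
    intro σ q
    simp only [hf]
    have hlin : ∀ b : ℝ, HasDerivAt (fun s => b * s) b σ := fun b => by
      simpa using (hasDerivAt_id σ).const_mul b
    exact (hlin _).sub ((((hlin ω).sin.const_mul _).sub
      ((hlin (2 * ω)).sin.const_mul _)).const_mul _)
  have hpos : ∀ σ q, 0 < g σ q := fun σ q => by
    rw [hg']
    positivity
  refine ⟨hpos, fun σ q => ?_, fun σ q => ?_⟩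
  · have hsqrt : ∀ r, Real.sqrt (g σ r) = Real.sqrt A
        * Real.exp (-(ω / lam / 2) * (r - q₀ * Real.cos (ω * σ)) ^ 2) := fun r => by
      rw [hg', sqrt_mul_exp_neg_sq hA.le]
    have hne : Real.sqrt A
        * Real.exp (-(ω / lam / 2) * (q - q₀ * Real.cos (ω * σ)) ^ 2) ≠ 0 := by positivity
    simp only [hsqrt]
    rw [(hfσ σ q).deriv, (hfq σ q).deriv, deriv_deriv_mul_exp_neg_sq, mul_div_cancel_left₀ _ hne,
      mul_assoc 2 ω σ, Real.cos_two_mul, mul_pow _ (Real.sin (ω * σ)), Real.sin_sq]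
    field_simp
    ring
  · have hu : HasDerivAt (fun s => q - q₀ * Real.cos (ω * s))
        (q₀ * (Real.sin (ω * σ) * ω)) σ := by
      refine ((((hasDerivAt_id σ).const_mul ω).cos.const_mul q₀).const_sub q).congr_deriv ?_
      simp
    simp only [fun p => (hfq σ p).deriv, hg']
    have hv : HasDerivAt (fun p => p - q₀ * Real.cos (ω * σ)) 1 q :=
      (hasDerivAt_id q).sub_const _
    rw [(hasDerivAt_mul_exp_neg_sq A (ω / lam) hu).deriv,
      ((hasDerivAt_mul_exp_neg_sq A (ω / lam) hv).mul_const _).deriv]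
    ring
end
end
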